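/- For all m, n ∈ ℕ and all t₂ ∈ [0,1], the iterated integral ∫₀¹ ( u_m(s) · ∫₀¹ 𝟙_{𝒫_s}(t₂,t₁) · u_n(t₁) dt₁ ) ds equals (√2/((n+1)·π)) · u_n(t₂) if m = n, and equals 0 if m ≠ n. That is, ∫₀¹ u_m(s)·N_s ds is (√2/((n+1)π)) times the orthogonal projection onto the span of u_n when m = n. -/

import Mathlib

open MeasureTheory Real

/-- `u n t = √2 · sin((n+1)·π·t)`. -/
noncomputable def u (n : ℕ) (t : ℝ) : ℝ := Real.sqrt 2 * Real.sin (((n : ℝ) + 1) * Real.pi * t)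

/-- The slice `𝒫_s ⊆ ℝ²`: pairs `(t₂, t₁) ∈ [0,1]²` with `s ≤ t₁+t₂ ≤ 2−s` and `|t₁−t₂| ≤ s`. -/
def Pslice (s : ℝ) : Set (ℝ × ℝ) :=
  {p | p.1 ∈ Set.Icc (0:ℝ) 1 ∧ p.2 ∈ Set.Icc (0:ℝ) 1 ∧
       s ≤ p.1 + p.2 ∧ p.1 + p.2 ≤ 2 - s ∧ |p.1 - p.2| ≤ s}

lemma cos_int_zero (j : ℤ) (hj : j ≠ 0) : ∫ s in (0:ℝ)..1, Real.cos ((j * π) * s) = 0 := by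
  have h : (j * π : ℝ) ≠ 0 := mul_ne_zero (by exact_mod_cast hj) Real.pi_ne_zero
  rw [intervalIntegral.integral_comp_mul_left (fun x => Real.cos x) h]
  simp [Real.sin_int_mul_pi]

lemma u_orth (m n : ℕ) : ∫ s in (0:ℝ)..1, u m s * u n s = if m = n then 1 else 0 := by
  have h2 : Real.sqrt 2 * Real.sqrt 2 = 2 := Real.mul_self_sqrt (by norm_num)
  have h : ∀ s, u m s * u n s =
      Real.cos ((((m:ℤ) - n : ℤ) * π) * s) - Real.cos ((((m:ℤ) + n + 2 : ℤ) * π) * s) := by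
    intro s
    have e1 : ((((m:ℤ) - n : ℤ) : ℝ) * π) * s = ((m:ℝ)+1) * π * s - ((n:ℝ)+1) * π * s := by
      push_cast; ring
    have e2 : ((((m:ℤ) + n + 2 : ℤ) : ℝ) * π) * s = ((m:ℝ)+1) * π * s + ((n:ℝ)+1) * π * s := by
      push_cast; ring
    rw [e1, e2, Real.cos_sub, Real.cos_add]
    unfold u
    linear_combination (Real.sin (((m:ℝ)+1) * π * s) * Real.sin (((n:ℝ)+1) * π * s)) * h2
  simp_rw [h]
  rw [intervalIntegral.integral_sub (Continuous.intervalIntegrable (by fun_prop) _ _)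
    (Continuous.intervalIntegrable (by fun_prop) _ _), cos_int_zero ((m:ℤ) + n + 2) (by omega)]
  split_ifs with hmn
  · subst hmn; simp
  · rw [cos_int_zero _ (by omega)]; simp

lemma inner_eq (n : ℕ) (t s : ℝ) (ht : t ∈ Set.Icc (0:ℝ) 1) (hs : s ∈ Set.Icc (0:ℝ) 1) :
    ∫ t₁ in (0:ℝ)..1, (Pslice s).indicator 1 (t, t₁) * u n t₁
      = (Real.sqrt 2 / (((n : ℝ) + 1) * π)) * u n t * u n s := by
  obtain ⟨ht0, ht1⟩ := ht
  obtain ⟨hs0, hs1⟩ := hs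
  have hle : |s - t| ≤ 1 - |1 - s - t| := by
    rcases abs_cases (s - t) with h | h <;> rcases abs_cases (1 - s - t) with h' | h' <;> linarith
  have hk : (((n : ℝ) + 1) * π) ≠ 0 := mul_ne_zero (by positivity) Real.pi_ne_zero
  have hset : ∀ x, (Pslice s).indicator (1 : ℝ × ℝ → ℝ) (t, x) * u n x =
      (Set.Icc |s - t| (1 - |1 - s - t|)).indicator (u n) x := by
    intro x
    have : (t, x) ∈ Pslice s ↔ x ∈ Set.Icc |s - t| (1 - |1 - s - t|) := by
      simp only [Pslice, Set.mem_setOf_eq, Set.mem_Icc]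
      constructor
      · rintro ⟨_, ⟨h1, h2⟩, h3, h4, h5⟩
        rw [abs_le] at h5
        constructor
        · rw [abs_le]; constructor <;> linarith
        · rw [le_sub_comm, abs_le]; constructor <;> linarith
      · rintro ⟨h1, h2⟩
        have h3 := abs_nonneg (s - t)
        have h4 := abs_nonneg (1 - s - t)
        rw [le_sub_comm, abs_le] at h2
        have h5 := abs_le.1 h1
        refine ⟨⟨ht0, ht1⟩, ⟨by linarith, by linarith⟩, by linarith, by linarith, ?_⟩
        rw [abs_le]; constructor <;> linarith
    by_cases hx : (t, x) ∈ Pslice s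
    · rw [Set.indicator_of_mem hx, Set.indicator_of_mem (this.1 hx)]; simp
    · rw [Set.indicator_of_notMem hx, Set.indicator_of_notMem (fun h => hx (this.2 h))]; simp
  simp_rw [hset]
  have hsub : Set.Icc |s - t| (1 - |1 - s - t|) ⊆ Set.Icc 0 1 :=
    Set.Icc_subset_Icc (abs_nonneg _) (by linarith [abs_nonneg (1 - s - t)])
  rw [intervalIntegral.integral_of_le zero_le_one, ← integral_Icc_eq_integral_Ioc,
    setIntegral_indicator measurableSet_Icc, Set.inter_eq_right.2 hsub,
    integral_Icc_eq_integral_Ioc, ← intervalIntegral.integral_of_le hle]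
  unfold u
  rw [intervalIntegral.integral_const_mul,
    intervalIntegral.integral_comp_mul_left (fun x => Real.sin x) hk, integral_sin]
  set k : ℝ := ((n : ℝ) + 1) * π with hkd
  have c1 : Real.cos (k * |s - t|) = Real.cos (k * s - k * t) := by
    rcases abs_cases (s - t) with h | h <;> rw [h.1]
    · congr 1; ring
    · rw [← Real.cos_neg]; congr 1; ring
  have c2 : Real.cos (k * (1 - |1 - s - t|)) = Real.cos (k * s + k * t) := by
    rcases abs_cases (1 - s - t) with h | h <;> rw [h.1]
    · congr 1; ring
    · rw [← Real.cos_neg, ← Real.cos_add_nat_mul_two_pi _ (n+1)]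
      congr 1; push_cast; rw [hkd]; ring
  have h2 : Real.sqrt 2 * Real.sqrt 2 = 2 := Real.mul_self_sqrt (by norm_num)
  rw [c1, c2, Real.cos_sub, Real.cos_add, smul_eq_mul]
  field_simp
  linear_combination (-Real.sin (k*s) * Real.sin (k*t)) * h2

/-- `∫₀¹ u_m(s)·(N_s u_n)(t₂) ds` equals `(√2/((n+1)π))·u_n(t₂)` if `m = n` and `0` otherwise. -/
theorem integral_um_Ns (m n : ℕ) (t₂ : ℝ) (ht₂ : t₂ ∈ Set.Icc (0:ℝ) 1) :
    (∫ s in (0:ℝ)..1, u m s * ∫ t₁ in (0:ℝ)..1, (Pslice s).indicator 1 (t₂, t₁) * u n t₁)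
      = if m = n then (Real.sqrt 2 / (((n : ℝ) + 1) * π)) * u n t₂ else 0 := by
  have : (∫ s in (0:ℝ)..1, u m s * ∫ t₁ in (0:ℝ)..1, (Pslice s).indicator 1 (t₂, t₁) * u n t₁)
      = ∫ s in (0:ℝ)..1, (Real.sqrt 2 / (((n : ℝ) + 1) * π) * u n t₂) * (u m s * u n s) := by
    apply intervalIntegral.integral_congr
    intro s hs
    rw [Set.uIcc_of_le zero_le_one] at hs
    simp only []
    rw [inner_eq n t₂ s ht₂ hs]
    ring
  rw [this, intervalIntegral.integral_const_mul, u_orth]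
  split_ifs <;> simp
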